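/- Let R be a noetherian K-algebra domain equipped with a rational action of a K-torus H of rank r by K-algebra automorphisms (encoded by a ℤʳ-grading of R as below), and assume R is a strong H-UFD. Then each normal element of R is an associate of an H-normal element, i.e., for every normal u ∈ R there is a unit a ∈ R and t ∈ (Kˣ)ʳ such that (a⁻¹u)·b = tᵐ·b·(a⁻¹u) for every m ∈ ℤʳ and every homogeneous b ∈ R_m. If all units of R are central, then every normal element of R is itself H-normal. -/

import Mathlib

/-- `u` is a normal element of `R`: `uR = Ru`. -/
def IsNormalElem {R : Type*} [Ring R] (u : R) : Prop :=
  {y : R | ∃ t : R, y = u * t} = {y : R | ∃ t : R, y = t * u}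

/-- For a normal element `u`, `u ∣ a` means `a ∈ Ru`. -/
def NDvd {R : Type*} [Ring R] (u a : R) : Prop := ∃ t : R, a = t * u

/-- A prime element of a domain `R`: a nonzero normal element `p` such that `Rp`
is a completely prime ideal of `R`; in particular `p` is not a unit
(`1 ∉ Rp`). -/
def IsPrimeElem {R : Type*} [Ring R] (p : R) : Prop :=
  p ≠ 0 ∧ IsNormalElem p ∧ ¬ NDvd p 1 ∧
    ∀ a b : R, NDvd p (a * b) → NDvd p a ∨ NDvd p b

/-- `S` is a two-sided ideal of `R`, as a set. -/
def IsIdealSet {R : Type*} [Ring R] (S : Set R) : Prop :=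
  (0 : R) ∈ S ∧ (∀ a ∈ S, ∀ b ∈ S, a + b ∈ S) ∧
    ∀ r : R, ∀ a ∈ S, r * a ∈ S ∧ a * r ∈ S

/-- `S` is a prime two-sided ideal of `R` (elementwise characterization:
`aRb ⊆ S` implies `a ∈ S` or `b ∈ S`, and `S` is proper). -/
def IsPrimeIdealSet {R : Type*} [Ring R] (S : Set R) : Prop :=
  IsIdealSet S ∧ (1 : R) ∉ S ∧
    ∀ a b : R, (∀ t : R, a * t * b ∈ S) → a ∈ S ∨ b ∈ S

/-- Noncommutative unique factorization domain condition: every nonzero prime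
ideal contains a prime element. -/
def IsNCUFD (R : Type*) [Ring R] : Prop :=
  ∀ S : Set R, IsPrimeIdealSet S → S ≠ {0} → ∃ p ∈ S, IsPrimeElem p

section GradedDefs

variable {K : Type*} [Field K] {R : Type*} [Ring R] [Algebra K R] {r : ℕ}

/-- `tᵐ = t₁^{m₁} ⋯ t_r^{m_r}` for a torus element `t ∈ (Kˣ)ʳ` and a character
`m ∈ ℤʳ`. -/
def tpow (t : Fin r → Kˣ) (m : Fin r → ℤ) : Kˣ := ∏ i, t i ^ m i

/-- A homogeneous (`H`-stable) two-sided ideal for the `ℤʳ`-grading `𝒜`. -/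
def IsHomogIdealSet (𝒜 : (Fin r → ℤ) → Submodule K R) [GradedAlgebra 𝒜]
    (S : Set R) : Prop :=
  IsIdealSet S ∧ ∀ a ∈ S, ∀ m : Fin r → ℤ, ((DirectSum.decompose 𝒜 a m : R) ∈ S)

/-- An `H`-prime ideal for the torus action encoded by the grading `𝒜`:
a proper homogeneous ideal `P` with `I·J ⊆ P → I ⊆ P ∨ J ⊆ P` for all
homogeneous ideals `I`, `J`. -/
def IsHPrimeIdealSet (𝒜 : (Fin r → ℤ) → Submodule K R) [GradedAlgebra 𝒜]
    (S : Set R) : Prop :=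
  IsHomogIdealSet 𝒜 S ∧ (1 : R) ∉ S ∧
    ∀ I J : Set R, IsHomogIdealSet 𝒜 I → IsHomogIdealSet 𝒜 J →
      (∀ a ∈ I, ∀ b ∈ J, a * b ∈ S) → I ⊆ S ∨ J ⊆ S

/-- `R` is an `H`-UFD for the torus action encoded by the grading `𝒜`: every
nonzero `H`-prime ideal contains a homogeneous prime element. -/
def IsHUFDg (𝒜 : (Fin r → ℤ) → Submodule K R) [GradedAlgebra 𝒜] : Prop :=
  ∀ S : Set R, IsHPrimeIdealSet 𝒜 S → S ≠ {0} →
    ∃ p ∈ S, IsPrimeElem p ∧ ∃ m : Fin r → ℤ, p ∈ 𝒜 m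

/-- `u` is `H`-normal for the torus action encoded by the grading `𝒜`:
there is `t ∈ (Kˣ)ʳ` with `u·b = tᵐ·b·u` for every homogeneous `b` of any
degree `m`. -/
def IsHNormalg (𝒜 : (Fin r → ℤ) → Submodule K R) (u : R) : Prop :=
  ∃ t : Fin r → Kˣ, ∀ m : Fin r → ℤ, ∀ b ∈ 𝒜 m,
    u * b = ((tpow t m : Kˣ) : K) • (b * u)

/-- An `H`-prime element: a prime element which is homogeneous and `H`-normal. -/
def IsHPrimeElemg (𝒜 : (Fin r → ℤ) → Submodule K R) (p : R) : Prop :=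
  IsPrimeElem p ∧ (∃ m : Fin r → ℤ, p ∈ 𝒜 m) ∧ IsHNormalg 𝒜 p

/-- `R` is a strong `H`-UFD for the torus action encoded by the grading `𝒜`:
every nonzero `H`-prime ideal contains an `H`-prime element. -/
def IsStrongHUFDg (𝒜 : (Fin r → ℤ) → Submodule K R) [GradedAlgebra 𝒜] : Prop :=
  ∀ S : Set R, IsHPrimeIdealSet 𝒜 S → S ≠ {0} → ∃ p ∈ S, IsHPrimeElemg 𝒜 p

end GradedDefs

section Normal

variable {R : Type*} [Ring R]

theorem IsNormalElem.exists_left {u : R} (hu : IsNormalElem u) (b : R) :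
    ∃ c, u * b = c * u := by
  have h : u * b ∈ {y : R | ∃ t : R, y = u * t} := ⟨b, rfl⟩
  rw [show {y : R | ∃ t : R, y = u * t} = {y : R | ∃ t : R, y = t * u} from hu] at h
  exact h

theorem IsNormalElem.exists_right {u : R} (hu : IsNormalElem u) (c : R) :
    ∃ b, u * b = c * u := by
  have h : c * u ∈ {y : R | ∃ t : R, y = t * u} := ⟨c, rfl⟩
  rw [← show {y : R | ∃ t : R, y = u * t} = {y : R | ∃ t : R, y = t * u} from hu] at h
  obtain ⟨b, hb⟩ := h
  exact ⟨b, hb.symm⟩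

theorem isNormalElem_of_exists {u : R} (h₁ : ∀ b, ∃ c, u * b = c * u)
    (h₂ : ∀ c, ∃ b, u * b = c * u) : IsNormalElem u := by
  ext y
  constructor
  · rintro ⟨t, rfl⟩
    exact h₁ t
  · rintro ⟨t, rfl⟩
    obtain ⟨b, hb⟩ := h₂ t
    exact ⟨b, hb.symm⟩

theorem IsNormalElem.of_mul_left [IsDomain R] {p v : R} (hp0 : p ≠ 0) (hp : IsNormalElem p)
    (hpv : IsNormalElem (p * v)) : IsNormalElem v := by
  refine isNormalElem_of_exists (fun b => ?_) fun c => ?_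
  · obtain ⟨c, hc⟩ := hpv.exists_left b
    obtain ⟨c', hc'⟩ := hp.exists_right c
    refine ⟨c', mul_left_cancel₀ hp0 ?_⟩
    rw [← mul_assoc, hc, ← mul_assoc, ← hc', mul_assoc]
  · obtain ⟨c', hc'⟩ := hp.exists_left c
    obtain ⟨b, hb⟩ := hpv.exists_right c'
    refine ⟨b, mul_left_cancel₀ hp0 ?_⟩
    rw [← mul_assoc, hb, ← mul_assoc, ← hc', mul_assoc]

theorem IsNormalElem.exists_unit [IsDomain R] {p : R} (hp0 : p ≠ 0) (hp : IsNormalElem p)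
    (a : Rˣ) : ∃ a' : Rˣ, p * a = a' * p := by
  obtain ⟨c, hc⟩ := hp.exists_left a
  obtain ⟨d, hd⟩ := hp.exists_left (a⁻¹ : Rˣ)
  refine ⟨⟨c, d, mul_right_cancel₀ hp0 ?_, mul_right_cancel₀ hp0 ?_⟩, hc⟩
  · rw [mul_assoc, ← hd, ← mul_assoc, ← hc]
    simp
  · rw [mul_assoc, ← hc, ← mul_assoc, ← hd]
    simp

theorem isIdealSet_span_of_isNormalElem {v : R} (hv : IsNormalElem v) :
    IsIdealSet {y : R | ∃ t, y = t * v} := by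
  refine ⟨⟨0, by simp⟩, ?_, ?_⟩
  · rintro _ ⟨s, rfl⟩ _ ⟨t, rfl⟩
    exact ⟨s + t, (add_mul _ _ _).symm⟩
  · rintro x _ ⟨t, rfl⟩
    refine ⟨⟨x * t, (mul_assoc _ _ _).symm⟩, ?_⟩
    obtain ⟨c, hc⟩ := hv.exists_left x
    exact ⟨t * c, by rw [mul_assoc, hc, mul_assoc]⟩

theorem IsIdealSet.exists_coe_eq {S : Set R} (hS : IsIdealSet S) :
    ∃ I : Ideal R, (I : Set R) = S :=
  ⟨{ carrier := S
     zero_mem' := hS.1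
     add_mem' := fun {a b} ha hb => hS.2.1 a ha b hb
     smul_mem' := fun c x hx => (hS.2.2 c x hx).1 }, rfl⟩

end Normal

section Graded

variable {K : Type*} [Field K] {R : Type*} [Ring R] [Algebra K R] {r : ℕ}
  (𝒜 : (Fin r → ℤ) → Submodule K R)

theorem isHNormalg_one : IsHNormalg 𝒜 1 :=
  ⟨1, fun m b _ => by simp [tpow]⟩

theorem isHNormalg_zero : IsHNormalg 𝒜 0 :=
  ⟨1, fun m b _ => by simp⟩

variable {𝒜} in
theorem IsHNormalg.mul {p c : R} (hp : IsHNormalg 𝒜 p) (hc : IsHNormalg 𝒜 c) :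
    IsHNormalg 𝒜 (p * c) := by
  obtain ⟨s, hs⟩ := hp
  obtain ⟨t, ht⟩ := hc
  refine ⟨s * t, fun m b hb => ?_⟩
  have hst : tpow (s * t) m = tpow s m * tpow t m := by
    simp [tpow, mul_zpow, Finset.prod_mul_distrib]
  rw [mul_assoc, ht m b hb, mul_smul_comm, ← mul_assoc, hs m b hb, hst, Units.val_mul,
    smul_mul_assoc, smul_smul, mul_comm (tpow s m : K), mul_assoc]

/-- A normal right factor of a product of `H`-prime elements is an associate of an
`H`-normal element. -/
theorem exists_unit_mul_isHNormalg_of_mul_eq_prod [IsDomain R] (L : List R)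
    (hL : ∀ p ∈ L, IsHPrimeElemg 𝒜 p) {v w : R} (hv : IsNormalElem v) (h : L.prod = w * v) :
    ∃ (a : Rˣ) (c : R), IsHNormalg 𝒜 c ∧ v = a * c := by
  induction L generalizing v w with
  | nil =>
    rw [List.prod_nil] at h
    refine ⟨⟨v, w, ?_, h.symm⟩, 1, isHNormalg_one 𝒜, by simp⟩
    have hv0 : v ≠ 0 := by
      rintro rfl
      simp at h
    refine mul_right_cancel₀ hv0 ?_
    rw [mul_assoc, ← h, mul_one, one_mul]
  | cons p L ih =>
    have ih := @ih fun q hq => hL q (List.mem_cons_of_mem _ hq)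
    obtain ⟨⟨hp0, hp, -, hprime⟩, -, hpH⟩ := hL p List.mem_cons_self
    rw [List.prod_cons] at h
    obtain ⟨q, hq⟩ := hp.exists_left L.prod
    rcases hprime w v ⟨q, by rw [← h, hq]⟩ with ⟨t, rfl⟩ | ⟨t, rfl⟩
    · obtain ⟨t', ht'⟩ := hp.exists_right t
      refine ih hv (w := t') (mul_left_cancel₀ hp0 ?_)
      rw [h, ← ht', mul_assoc]
    · obtain ⟨t', ht'⟩ := hp.exists_right t
      obtain ⟨w', hw'⟩ := hp.exists_right w
      rw [← ht'] at hv h ⊢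
      obtain ⟨a, c, hc, rfl⟩ := ih (hp.of_mul_left hp0 hv) (w := w') (mul_left_cancel₀ hp0 (by
        rw [h, ← mul_assoc, ← hw', mul_assoc]))
      obtain ⟨a', ha'⟩ := hp.exists_unit hp0 a
      exact ⟨a', p * c, hpH.mul hc, by rw [← mul_assoc, ha', mul_assoc]⟩

variable [GradedAlgebra 𝒜]

variable {𝒜} in
theorem IsHomogIdealSet.add {I J : Set R} (hI : IsHomogIdealSet 𝒜 I) (hJ : IsHomogIdealSet 𝒜 J) :
    IsHomogIdealSet 𝒜 {y | ∃ a ∈ I, ∃ b ∈ J, y = a + b} := by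
  refine ⟨⟨⟨0, hI.1.1, 0, hJ.1.1, by simp⟩, ?_, ?_⟩, ?_⟩
  · rintro _ ⟨a, ha, b, hb, rfl⟩ _ ⟨a', ha', b', hb', rfl⟩
    exact ⟨a + a', hI.1.2.1 _ ha _ ha', b + b', hJ.1.2.1 _ hb _ hb', add_add_add_comm _ _ _ _⟩
  · rintro x _ ⟨a, ha, b, hb, rfl⟩
    exact ⟨⟨x * a, (hI.1.2.2 x a ha).1, x * b, (hJ.1.2.2 x b hb).1, mul_add _ _ _⟩,
      ⟨a * x, (hI.1.2.2 x a ha).2, b * x, (hJ.1.2.2 x b hb).2, add_mul _ _ _⟩⟩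
  · rintro _ ⟨a, ha, b, hb, rfl⟩ m
    exact ⟨_, hI.2 a ha m, _, hJ.2 b hb m, by simp [DirectSum.decompose_add]⟩

variable {𝒜} in
/-- In a noetherian strong `H`-UFD, nonzero homogeneous ideals contain products of `H`-primes. -/
theorem IsStrongHUFDg.exists_prod_mem [IsNoetherianRing R] (hR : IsStrongHUFDg 𝒜)
    {S : Set R} (hS : IsHomogIdealSet 𝒜 S) (hS0 : S ≠ {0}) :
    ∃ L : List R, (∀ p ∈ L, IsHPrimeElemg 𝒜 p) ∧ L.prod ∈ S := by
  obtain ⟨N, hN⟩ := hS.1.exists_coe_eq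
  induction N using WellFoundedGT.induction generalizing S with
  | ind N ih =>
  by_cases h1 : (1 : R) ∈ S
  · exact ⟨[], by simp, by simpa⟩
  by_cases hP : IsHPrimeIdealSet 𝒜 S
  · obtain ⟨p, hpS, hp⟩ := hR S hP hS0
    exact ⟨[p], by simpa, by simpa⟩
  have hex : ∃ I J : Set R, IsHomogIdealSet 𝒜 I ∧ IsHomogIdealSet 𝒜 J ∧
      (∀ a ∈ I, ∀ b ∈ J, a * b ∈ S) ∧ ¬ I ⊆ S ∧ ¬ J ⊆ S := by
    by_contra hno
    refine hP ⟨hS, h1, fun I J hI hJ hIJ => ?_⟩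
    by_contra hor
    rw [not_or] at hor
    exact hno ⟨I, J, hI, hJ, hIJ, hor⟩
  obtain ⟨I, J, hI, hJ, hIJ, hIS, hJS⟩ := hex
  have key : ∀ I : Set R, IsHomogIdealSet 𝒜 I → ¬ I ⊆ S →
      ∃ L : List R, (∀ p ∈ L, IsHPrimeElemg 𝒜 p) ∧ ∃ a ∈ I, ∃ b ∈ S, L.prod = a + b := by
    intro I hI hIS
    have hIS' := hI.add hS
    obtain ⟨M, hM⟩ := hIS'.1.exists_coe_eq
    have hsub : S ⊆ {y | ∃ a ∈ I, ∃ b ∈ S, y = a + b} :=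
      fun b hb => ⟨0, hI.1.1, b, hb, (zero_add b).symm⟩
    refine ih M ?_ hIS' ?_ hM
    · refine (SetLike.coe_ssubset_coe (S := N) (T := M)).mp ?_
      rw [hN, hM]
      refine ⟨hsub, fun hle => hIS fun a ha => hle ⟨a, ha, 0, hS.1.1, (add_zero a).symm⟩⟩
    · intro h0
      rw [h0] at hsub
      exact hS0 (hsub.antisymm (by simpa using hS.1.1))
  obtain ⟨L, hL, a, ha, b, hb, hab⟩ := key I hI hIS
  obtain ⟨L', hL', a', ha', b', hb', hab'⟩ := key J hJ hJS
  refine ⟨L ++ L', fun p hp => (List.mem_append.mp hp).elim (hL p) (hL' p), ?_⟩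
  rw [List.prod_append, hab, hab', mul_add, add_mul]
  exact hS.1.2.1 _ (hS.1.2.1 _ (hIJ a ha a' ha') _ (hS.1.2.2 a' b hb).2) _
    (hS.1.2.2 (a + b) b' hb').1

theorem isHomogIdealSet_span_of_isNormalElem {v : R} (hv : IsNormalElem v) {d : Fin r → ℤ}
    (hd : v ∈ 𝒜 d) : IsHomogIdealSet 𝒜 {y : R | ∃ t, y = t * v} := by
  refine ⟨isIdealSet_span_of_isNormalElem hv, ?_⟩
  rintro _ ⟨t, rfl⟩ m
  refine ⟨DirectSum.decompose 𝒜 t (m - d), ?_⟩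
  rw [← DirectSum.coe_decompose_mul_add_of_right_mem 𝒜 hd, sub_add_cancel]

/-- Leading-term comparison: if `u * b = c * u` with `b` of degree `d`, then no component of `c`
has degree beyond `d` for a linear order on the degrees. -/
theorem le_of_mul_eq_mul_of_mem [IsDomain R] {Γ : Type*} [AddCommGroup Γ] [LinearOrder Γ]
    [IsOrderedAddMonoid Γ] (f : (Fin r → ℤ) →+ Γ) (hf : Function.Injective f)
    {u b c : R} (hu : u ≠ 0) {d : Fin r → ℤ} (hb : b ∈ 𝒜 d) (h : u * b = c * u)
    {n : Fin r → ℤ} (hn : (DirectSum.decompose 𝒜 c n : R) ≠ 0) : f n ≤ f d := by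
  classical
  have hsupp : ∀ (x : R) (i : Fin r → ℤ), i ∈ (DirectSum.decompose 𝒜 x).support ↔
      (DirectSum.decompose 𝒜 x i : R) ≠ 0 := fun x i => by simp
  have hune : (DirectSum.decompose 𝒜 u).support.Nonempty := by
    rw [Finset.nonempty_iff_ne_empty, Ne, DFinsupp.support_eq_empty]
    exact fun h0 => hu ((DirectSum.decompose 𝒜).injective (by rw [h0, DirectSum.decompose_zero]))
  obtain ⟨M, hM, hMmax⟩ := Finset.exists_max_image _ f hune
  obtain ⟨N, hN, hNmax⟩ := Finset.exists_max_image (DirectSum.decompose 𝒜 c).support f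
    ⟨n, (hsupp c n).mpr hn⟩
  refine (hNmax n ((hsupp c n).mpr hn)).trans ?_
  have htop : (DirectSum.decompose 𝒜 (c * u) (N + M) : R) =
      DirectSum.decompose 𝒜 c N * DirectSum.decompose 𝒜 u M := by
    rw [DirectSum.decompose_mul, DirectSum.coe_mul_apply]
    refine Finset.sum_eq_single_of_mem (N, M) (by simp_all) ?_
    rintro ⟨i, j⟩ hij hne
    simp only [Finset.mem_filter, Finset.mem_product] at hij
    obtain ⟨⟨hi, hj⟩, hs⟩ := hij
    have hi' := hNmax i hi
    have hj' := hMmax j hj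
    have hs' : f i + f j = f N + f M := by rw [← map_add, hs, map_add]
    have hiN : f i = f N := by
      refine le_antisymm hi' (le_of_not_gt fun hlt => ?_)
      exact (add_lt_add_of_lt_of_le hlt hj').ne hs'
    have hjM : f j = f M := by
      rw [hiN] at hs'
      exact add_left_cancel hs'
    exact absurd (Prod.ext (hf hiN) (hf hjM)) hne
  have hdeg : (DirectSum.decompose 𝒜 (u * b) (N + M) : R) =
      DirectSum.decompose 𝒜 u (N + M - d) * b := by
    rw [← DirectSum.coe_decompose_mul_add_of_right_mem 𝒜 hb, sub_add_cancel]
  have hmem : N + M - d ∈ (DirectSum.decompose 𝒜 u).support := by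
    refine (hsupp u _).mpr fun h0 => ?_
    rw [h0, zero_mul, h, htop] at hdeg
    exact mul_ne_zero ((hsupp c N).mp hN) ((hsupp u M).mp hM) hdeg
  have := hMmax _ hmem
  rw [map_sub, map_add, sub_le_iff_le_add, add_comm] at this
  exact le_of_add_le_add_left this

/-- Conjugation by a normal element preserves degrees. -/
theorem mem_of_mul_eq_mul_of_mem [IsDomain R] {u b c : R} (hu : u ≠ 0) {d : Fin r → ℤ}
    (hb : b ∈ 𝒜 d) (h : u * b = c * u) : c ∈ 𝒜 d := by
  classical
  let f : (Fin r → ℤ) →+ Lex (Fin r → ℤ) := AddMonoidHom.mk' toLex fun _ _ => rfl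
  have hf : Function.Injective f := toLex.injective
  have hzero : ∀ n, n ≠ d → (DirectSum.decompose 𝒜 c n : R) = 0 := by
    intro n hnd
    by_contra hn
    have h₁ := le_of_mul_eq_mul_of_mem 𝒜 f hf hu hb h hn
    have h₂ := le_of_mul_eq_mul_of_mem 𝒜 (-f) (fun x y hxy => hf (neg_injective hxy)) hu hb h hn
    exact hnd (hf (le_antisymm h₁ (neg_le_neg_iff.mp h₂)))
  have hc : c = DirectSum.decompose 𝒜 c d := by
    conv_lhs => rw [← DirectSum.sum_support_decompose 𝒜 c]
    refine Finset.sum_eq_single d (fun n _ hn => hzero n hn) fun hd => ?_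
    simpa using hd
  rw [hc]
  exact SetLike.coe_mem _

/-- The homogeneous components of a normal element induce the same conjugation. -/
theorem decompose_mul_eq_mul_decompose [IsDomain R] {u : R} (hu : u ≠ 0) (hun : IsNormalElem u)
    (m : Fin r → ℤ) {b c : R} (h : u * b = c * u) :
    (DirectSum.decompose 𝒜 u m : R) * b = c * DirectSum.decompose 𝒜 u m := by
  classical
  choose φ hφ using hun.exists_left
  have hhom : ∀ d, ∀ x ∈ 𝒜 d,
      (DirectSum.decompose 𝒜 u m : R) * x = φ x * DirectSum.decompose 𝒜 u m := by
    intro d x hx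
    have hφx := mem_of_mul_eq_mul_of_mem 𝒜 hu hx (hφ x)
    rw [← DirectSum.coe_decompose_mul_add_of_right_mem 𝒜 hx, hφ x, add_comm,
      DirectSum.coe_decompose_mul_add_of_left_mem 𝒜 hφx]
  have hc : c = ∑ i ∈ (DirectSum.decompose 𝒜 b).support, φ (DirectSum.decompose 𝒜 b i) := by
    refine mul_right_cancel₀ hu ?_
    rw [← h, Finset.sum_mul]
    simp_rw [← hφ]
    rw [← Finset.mul_sum, DirectSum.sum_support_decompose]
  conv_lhs => rw [← DirectSum.sum_support_decompose 𝒜 b]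
  rw [hc, Finset.mul_sum, Finset.sum_mul]
  exact Finset.sum_congr rfl fun i _ => hhom i _ (SetLike.coe_mem _)

variable {𝒜} in
/-- In a noetherian strong `H`-UFD, conjugation by a nonzero normal element is conjugation by a
unit followed by the action of a torus element. -/
theorem IsStrongHUFDg.exists_unit_torus_of_isNormalElem [IsDomain R] [IsNoetherianRing R]
    (hR : IsStrongHUFDg 𝒜) {u : R} (hu : u ≠ 0) (hun : IsNormalElem u) :
    ∃ (a : Rˣ) (t : Fin r → Kˣ), ∀ m : Fin r → ℤ, ∀ b ∈ 𝒜 m,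
      u * b = ((tpow t m : Kˣ) : K) • (a * b * (a⁻¹ : Rˣ) * u) := by
  obtain ⟨d, hd⟩ : ∃ d, (DirectSum.decompose 𝒜 u d : R) ≠ 0 := by
    by_contra! hall
    refine hu ((DirectSum.decompose 𝒜).injective ?_)
    ext i
    rw [hall i, DirectSum.decompose_zero]
    simp
  have hvn : IsNormalElem (DirectSum.decompose 𝒜 u d : R) := by
    refine isNormalElem_of_exists (fun b => ?_) fun c => ?_
    · obtain ⟨c, hc⟩ := hun.exists_left b
      exact ⟨c, decompose_mul_eq_mul_decompose 𝒜 hu hun d hc⟩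
    · obtain ⟨b, hb⟩ := hun.exists_right c
      exact ⟨b, decompose_mul_eq_mul_decompose 𝒜 hu hun d hb⟩
  obtain ⟨L, hL, w, hw⟩ := hR.exists_prod_mem
    (isHomogIdealSet_span_of_isNormalElem 𝒜 hvn (SetLike.coe_mem _)) (by
      intro h0
      have : (DirectSum.decompose 𝒜 u d : R) ∈ ({0} : Set R) := by
        rw [← h0]
        exact ⟨1, (one_mul _).symm⟩
      exact hd this)
  obtain ⟨a, c, ⟨t, ht⟩, hac⟩ := exists_unit_mul_isHNormalg_of_mul_eq_prod 𝒜 L hL hvn hw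
  refine ⟨a, t, fun m b hb => ?_⟩
  obtain ⟨b', hb'⟩ := hun.exists_left b
  have hv := decompose_mul_eq_mul_decompose 𝒜 hu hun d hb'
  have hc0 : c ≠ 0 := by
    rintro rfl
    exact hd (by rw [hac, mul_zero])
  have hab : ((tpow t m : Kˣ) : K) • ((a : R) * b) = b' * a := by
    refine mul_right_cancel₀ hc0 ?_
    rw [hac, mul_assoc, ht m b hb, mul_smul_comm] at hv
    rw [smul_mul_assoc, mul_assoc, hv, mul_assoc]
  rw [← smul_mul_assoc, ← smul_mul_assoc, hab, hb', mul_assoc b', Units.mul_inv, mul_one]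

end Graded

/-- **Theorem 2.5** of Goodearl–Yakimov: in a noetherian strong `H`-UFD, every
normal element is an associate of an `H`-normal element; if all units are
central, every normal element is `H`-normal. -/
theorem stmt7 {K : Type*} [Field K] {R : Type*} [Ring R] [Algebra K R]
    [IsDomain R] [IsNoetherianRing R] [IsNoetherianRing Rᵐᵒᵖ]
    {r : ℕ} (𝒜 : (Fin r → ℤ) → Submodule K R) [GradedAlgebra 𝒜]
    (hR : IsStrongHUFDg 𝒜) :
    (∀ u : R, IsNormalElem u →
      ∃ a : Rˣ, IsHNormalg 𝒜 (((a⁻¹ : Rˣ) : R) * u)) ∧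
    ((∀ v : Rˣ, ∀ w : R, (v : R) * w = w * (v : R)) →
      ∀ u : R, IsNormalElem u → IsHNormalg 𝒜 u) := by
  refine ⟨fun u hun => ?_, fun hcentral u hun => ?_⟩
  · rcases eq_or_ne u 0 with rfl | hu
    · exact ⟨1, by simpa using isHNormalg_zero 𝒜⟩
    obtain ⟨a, t, h⟩ := hR.exists_unit_torus_of_isNormalElem hu hun
    refine ⟨a, t, fun m b hb => ?_⟩
    rw [mul_assoc, h m b hb, mul_smul_comm]
    simp [mul_assoc]
  · rcases eq_or_ne u 0 with rfl | hu
    · exact isHNormalg_zero 𝒜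
    obtain ⟨a, t, h⟩ := hR.exists_unit_torus_of_isNormalElem hu hun
    refine ⟨t, fun m b hb => ?_⟩
    rw [h m b hb, hcentral a b, Units.mul_inv_cancel_right]
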